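/- arXiv:1601.01212 — 2 statements merged into one kernel-verified Lean document; each statement's English description precedes it below -/
import Mathlib

section
/- For an N-qubit system and pairwise distinct sites i, j, k, ℓ, the commutator identity i[H_{ij}, H_{jkℓ}] = 2(H_{ik}H_{jℓ} − H_{iℓ}H_{jk}) holds, where H_{mn} = σ^(m)·σ^(n) and H_{jkℓ} = σ^(j)·(σ^(k)×σ^(ℓ)). -/
/- N-qubit operators: matrices indexed by `Fin N → Fin 2`, identified with
Kronecker products. Sites are labeled `1, …, N`. -/

noncomputable def pauli : Fin 3 → Matrix (Fin 2) (Fin 2) ℂ :=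
  ![!![0, 1; 1, 0], !![0, -Complex.I; Complex.I, 0], !![1, 0; 0, -1]]

/-- The Pauli matrix `σ_a` acting on qubit `n` (sites labeled `1, …, N`) and as the
identity elsewhere. -/
noncomputable def pauliAt (N n : ℕ) (a : Fin 3) :
    Matrix (Fin N → Fin 2) (Fin N → Fin 2) ℂ :=
  Matrix.of fun f g =>
    ∏ m : Fin N, if (m : ℕ) + 1 = n then pauli a (f m) (g m)
      else (if f m = g m then 1 else 0)

/-- `H_{mn} = σ^(m) · σ^(n)`. -/
noncomputable def twoBody (N m n : ℕ) : Matrix (Fin N → Fin 2) (Fin N → Fin 2) ℂ :=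
  ∑ a : Fin 3, pauliAt N m a * pauliAt N n a

/-- Levi-Civita symbol on `Fin 3`. -/
def eps (a b c : Fin 3) : ℂ :=
  if (a, b, c) = (0, 1, 2) ∨ (a, b, c) = (1, 2, 0) ∨ (a, b, c) = (2, 0, 1) then 1
  else if (a, b, c) = (2, 1, 0) ∨ (a, b, c) = (1, 0, 2) ∨ (a, b, c) = (0, 2, 1) then -1
  else 0

/-- `H_{ijk} = σ^(i) · (σ^(j) × σ^(k))`. -/
noncomputable def threeBody (N i j k : ℕ) : Matrix (Fin N → Fin 2) (Fin N → Fin 2) ℂ :=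
  ∑ a : Fin 3, ∑ b : Fin 3, ∑ c : Fin 3,
    eps a b c • (pauliAt N i a * pauliAt N j b * pauliAt N k c)

/-- The tensor product `⨂ m, A m` of one-qubit matrices. -/
noncomputable def tensorMatrix {N : ℕ} (A : Fin N → Matrix (Fin 2) (Fin 2) ℂ) :
    Matrix (Fin N → Fin 2) (Fin N → Fin 2) ℂ :=
  Matrix.of fun f g => ∏ m, A m (f m) (g m)

theorem tensorMatrix_mul {N : ℕ} (A B : Fin N → Matrix (Fin 2) (Fin 2) ℂ) :
    tensorMatrix A * tensorMatrix B = tensorMatrix (A * B) := by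
  ext f g
  simp only [tensorMatrix, Matrix.mul_apply, Matrix.of_apply, Pi.mul_apply,
    ← Finset.prod_mul_distrib]
  rw [Finset.prod_univ_sum, Fintype.piFinset_univ]

/-- The one-qubit matrix `X` acting on qubit `p`, and the identity elsewhere. -/
noncomputable def siteMatrix {N : ℕ} (p : Fin N) (X : Matrix (Fin 2) (Fin 2) ℂ) :
    Matrix (Fin N → Fin 2) (Fin N → Fin 2) ℂ :=
  tensorMatrix (Pi.mulSingle p X)

theorem siteMatrix_mul {N : ℕ} (p : Fin N) (X Y : Matrix (Fin 2) (Fin 2) ℂ) :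
    siteMatrix p X * siteMatrix p Y = siteMatrix p (X * Y) := by
  rw [siteMatrix, siteMatrix, siteMatrix, tensorMatrix_mul, Pi.mulSingle_mul]

theorem siteMatrix_commute {N : ℕ} {p q : Fin N} (hpq : p ≠ q)
    (X Y : Matrix (Fin 2) (Fin 2) ℂ) : Commute (siteMatrix p X) (siteMatrix q Y) := by
  have h := Pi.mulSingle_commute (f := fun _ : Fin N => Matrix (Fin 2) (Fin 2) ℂ) hpq X Y
  rw [Commute, SemiconjBy, siteMatrix, siteMatrix, tensorMatrix_mul, tensorMatrix_mul, h.eq]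

theorem siteMatrix_apply {N : ℕ} (p : Fin N) (X : Matrix (Fin 2) (Fin 2) ℂ)
    (f g : Fin N → Fin 2) :
    siteMatrix p X f g =
      X (f p) (g p) * ∏ m ∈ Finset.univ.erase p, (1 : Matrix (Fin 2) (Fin 2) ℂ) (f m) (g m) := by
  rw [siteMatrix, tensorMatrix, Matrix.of_apply, ← Finset.mul_prod_erase _ _ (Finset.mem_univ p),
    Pi.mulSingle_eq_same]
  congr 1
  refine Finset.prod_congr rfl fun m hm => ?_
  rw [Pi.mulSingle_eq_of_ne (Finset.ne_of_mem_erase hm)]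

theorem siteMatrix_sub {N : ℕ} (p : Fin N) (X Y : Matrix (Fin 2) (Fin 2) ℂ) :
    siteMatrix p (X - Y) = siteMatrix p X - siteMatrix p Y := by
  ext f g
  simp only [siteMatrix_apply, Matrix.sub_apply, sub_mul]

theorem siteMatrix_smul {N : ℕ} (p : Fin N) (c : ℂ) (X : Matrix (Fin 2) (Fin 2) ℂ) :
    siteMatrix p (c • X) = c • siteMatrix p X := by
  ext f g
  simp only [siteMatrix_apply, Matrix.smul_apply, smul_eq_mul, mul_assoc]

theorem siteMatrix_sum {N : ℕ} {ι : Type*} (s : Finset ι) (p : Fin N)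
    (X : ι → Matrix (Fin 2) (Fin 2) ℂ) :
    siteMatrix p (∑ c ∈ s, X c) = ∑ c ∈ s, siteMatrix p (X c) := by
  ext f g
  simp only [siteMatrix_apply, Matrix.sum_apply, Finset.sum_mul]

theorem pauliAt_eq_siteMatrix {N : ℕ} (p : Fin N) (a : Fin 3) :
    pauliAt N (p + 1) a = siteMatrix p (pauli a) := by
  ext f g
  rw [pauliAt, siteMatrix, tensorMatrix, Matrix.of_apply, Matrix.of_apply]
  refine Finset.prod_congr rfl fun m _ => ?_
  by_cases h : m = p
  · subst h
    simp
  · have h' : (m : ℕ) ≠ p := fun e => h (Fin.ext e)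
    simp [h, h', Matrix.one_apply]

theorem pauli_commutator (a b : Fin 3) :
    pauli a * pauli b - pauli b * pauli a =
      (2 * Complex.I) • ∑ c : Fin 3, eps a b c • pauli c := by
  fin_cases a <;> fin_cases b <;> ext x y <;> fin_cases x <;> fin_cases y <;>
    simp [pauli, eps] <;>
    ring_nf <;> simp

theorem pauliAt_commute {N m n : ℕ} (hm : 1 ≤ m) (hn : 1 ≤ n) (hmN : m ≤ N) (hnN : n ≤ N)
    (hmn : m ≠ n) (a b : Fin 3) : Commute (pauliAt N m a) (pauliAt N n b) := by
  obtain ⟨m, rfl⟩ := Nat.exists_eq_add_of_le' hm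
  obtain ⟨n, rfl⟩ := Nat.exists_eq_add_of_le' hn
  have h := siteMatrix_commute (p := (⟨m, hmN⟩ : Fin N)) (q := ⟨n, hnN⟩)
    (fun e => hmn (congrArg (· + 1) (Fin.mk.inj e))) (pauli a) (pauli b)
  rwa [← pauliAt_eq_siteMatrix, ← pauliAt_eq_siteMatrix] at h

theorem pauliAt_commutator {N n : ℕ} (hn : 1 ≤ n) (hnN : n ≤ N) (a b : Fin 3) :
    pauliAt N n a * pauliAt N n b - pauliAt N n b * pauliAt N n a =
      (2 * Complex.I) • ∑ c : Fin 3, eps a b c • pauliAt N n c := by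
  obtain ⟨n, rfl⟩ := Nat.exists_eq_add_of_le' hn
  have h (c : Fin 3) : pauliAt N (n + 1) c = siteMatrix ⟨n, hnN⟩ (pauli c) :=
    pauliAt_eq_siteMatrix (⟨n, hnN⟩ : Fin N) c
  simp only [h, siteMatrix_mul, ← siteMatrix_sub, pauli_commutator, siteMatrix_smul,
    siteMatrix_sum]

theorem mul_commutator_of_commute {R : Type*} [Ring R] {A X Y K L : R}
    (hAY : Commute A Y) (hAK : Commute A K) (hAL : Commute A L)
    (hXK : Commute X K) (hXL : Commute X L) :
    A * X * (Y * K * L) - Y * K * L * (A * X) = A * ((X * Y - Y * X) * (K * L)) := by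
  have hA : Commute A (Y * K * L) := (hAY.mul_right hAK).mul_right hAL
  have hX : Commute X (K * L) := hXK.mul_right hXL
  rw [← mul_assoc (Y * K * L), ← hA.eq, mul_assoc A, mul_assoc A, ← mul_sub, sub_mul,
    mul_assoc Y K, mul_assoc Y, ← hX.eq]
  simp only [mul_assoc]

/-- For pairwise distinct sites `i, j, k, ℓ` of an `N`-qubit system,
`i[H_{ij}, H_{jkℓ}] = 2(H_{ik}H_{jℓ} − H_{iℓ}H_{jk})`. -/
theorem comm_twoBody_threeBody_fourSites (N i j k l : ℕ)
    (hi : 1 ≤ i) (hj : 1 ≤ j) (hk : 1 ≤ k) (hl : 1 ≤ l)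
    (hiN : i ≤ N) (hjN : j ≤ N) (hkN : k ≤ N) (hlN : l ≤ N)
    (hij : i ≠ j) (hik : i ≠ k) (hil : i ≠ l)
    (hjk : j ≠ k) (hjl : j ≠ l) (hkl : k ≠ l) :
    Complex.I • (twoBody N i j * threeBody N j k l - threeBody N j k l * twoBody N i j)
      = (2 : ℂ) • (twoBody N i k * twoBody N j l - twoBody N i l * twoBody N j k) := by
  have hI : Complex.I * (2 * Complex.I) = -2 := by linear_combination 2 * Complex.I_mul_I
  have hT (a b c d : Fin 3) :
      pauliAt N i a * pauliAt N j a * (pauliAt N j b * pauliAt N k c * pauliAt N l d) -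
        pauliAt N j b * pauliAt N k c * pauliAt N l d * (pauliAt N i a * pauliAt N j a) =
      (2 * Complex.I) • ∑ e : Fin 3, eps a b e •
        (pauliAt N i a * (pauliAt N j e * (pauliAt N k c * pauliAt N l d))) := by
    rw [mul_commutator_of_commute (pauliAt_commute hi hj hiN hjN hij a b)
      (pauliAt_commute hi hk hiN hkN hik a c) (pauliAt_commute hi hl hiN hlN hil a d)
      (pauliAt_commute hj hk hjN hkN hjk a c) (pauliAt_commute hj hl hjN hlN hjl a d),
      pauliAt_commutator hj hjN]
    simp only [Finset.sum_mul, Finset.mul_sum, smul_mul_assoc, mul_smul_comm]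
  have hL : twoBody N i j * threeBody N j k l - threeBody N j k l * twoBody N i j =
      (2 * Complex.I) • ∑ a : Fin 3, ∑ b : Fin 3, ∑ c : Fin 3, ∑ d : Fin 3, ∑ e : Fin 3,
        (eps b c d * eps a b e) •
          (pauliAt N i a * (pauliAt N j e * (pauliAt N k c * pauliAt N l d))) := by
    rw [twoBody, Finset.sum_mul, Finset.mul_sum, ← Finset.sum_sub_distrib, Finset.smul_sum]
    refine Finset.sum_congr rfl fun a _ => ?_
    simp only [threeBody, Finset.mul_sum, Finset.sum_mul, ← Finset.sum_sub_distrib,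
      mul_smul_comm, smul_mul_assoc, ← smul_sub, hT, Finset.smul_sum, smul_smul]
    simp only [mul_left_comm, mul_assoc]
  have hikjl (a b : Fin 3) :
      pauliAt N i a * pauliAt N k a * (pauliAt N j b * pauliAt N l b) =
        pauliAt N i a * (pauliAt N j b * (pauliAt N k a * pauliAt N l b)) := by
    rw [mul_assoc, ← mul_assoc (pauliAt N k a),
      (pauliAt_commute hk hj hkN hjN hjk.symm a b).eq, mul_assoc]
  have hiljk (a b : Fin 3) :
      pauliAt N i a * pauliAt N l a * (pauliAt N j b * pauliAt N k b) =
        pauliAt N i a * (pauliAt N j b * (pauliAt N k b * pauliAt N l a)) := by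
    rw [mul_assoc, ((pauliAt_commute hl hj hlN hjN hjl.symm a b).mul_right
      (pauliAt_commute hl hk hlN hkN hkl.symm a b)).eq, mul_assoc]
  rw [hL, smul_smul, hI]
  simp only [twoBody, Finset.sum_mul_sum, hikjl, hiljk]
  simp [Fin.sum_univ_three, eps]
  module
end

section
/- For an N-qubit system and pairwise distinct sites i, j, k, ℓ, the commutator identity i[H_{ijk}, H_{ij}H_{kℓ}] = 4(H_{jℓ} − H_{iℓ}) + 2(H_{iℓ}H_{jk} − H_{ik}H_{jℓ}) holds, where H_{mn} = σ^(m)·σ^(n) and H_{ijk} = σ^(i)·(σ^(j)×σ^(k)). -/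
/-- The operator acting as `A` on qubit `n` and as the identity elsewhere. -/
noncomputable def siteOp (N n : ℕ) (A : Matrix (Fin 2) (Fin 2) ℂ) :
    Matrix (Fin N → Fin 2) (Fin N → Fin 2) ℂ :=
  Matrix.of fun f g => ∏ m : Fin N, (if (m : ℕ) + 1 = n then A else 1) (f m) (g m)

theorem pauliAt_eq_siteOp (N n : ℕ) (a : Fin 3) : pauliAt N n a = siteOp N n (pauli a) := by
  ext f g
  simp only [pauliAt, siteOp, Matrix.of_apply]
  refine Finset.prod_congr rfl fun m _ => ?_
  split_ifs <;> simp_all [Matrix.one_apply]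

/-- Products of tensor-product operators are computed sitewise. -/
theorem tensor_mul {N : ℕ} (A B : Fin N → Matrix (Fin 2) (Fin 2) ℂ) :
    (Matrix.of fun f g : Fin N → Fin 2 => ∏ m, A m (f m) (g m)) *
        (Matrix.of fun f g : Fin N → Fin 2 => ∏ m, B m (f m) (g m)) =
      Matrix.of fun f g => ∏ m, (A m * B m) (f m) (g m) := by
  ext f g
  simp only [Matrix.mul_apply, Matrix.of_apply, ← Finset.prod_mul_distrib]
  rw [Finset.prod_univ_sum, Fintype.piFinset_univ]

theorem siteOp_mul (N n : ℕ) (A B : Matrix (Fin 2) (Fin 2) ℂ) :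
    siteOp N n A * siteOp N n B = siteOp N n (A * B) := by
  rw [siteOp, siteOp, tensor_mul, siteOp]
  ext f g
  simp only [Matrix.of_apply]
  refine Finset.prod_congr rfl fun m _ => ?_
  split_ifs <;> simp

theorem siteOp_one (N n : ℕ) : siteOp N n 1 = 1 := by
  ext f g
  simp [siteOp, Matrix.one_apply, Finset.prod_ite_zero, funext_iff]

theorem siteOp_smul (N n : ℕ) (hn : 1 ≤ n) (hnN : n ≤ N) (c : ℂ)
    (A : Matrix (Fin 2) (Fin 2) ℂ) : siteOp N n (c • A) = c • siteOp N n A := by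
  have hm : (⟨n - 1, by omega⟩ : Fin N) ∈ Finset.univ := Finset.mem_univ _
  ext f g
  simp only [siteOp, Matrix.of_apply, Matrix.smul_apply, smul_eq_mul]
  rw [← Finset.mul_prod_erase _ _ hm, ← Finset.mul_prod_erase _ _ hm, ← mul_assoc]
  congr 1
  · simp [Nat.sub_add_cancel hn]
  · refine Finset.prod_congr rfl fun m h => ?_
    have h_ne : (m : ℕ) + 1 ≠ n := by
      rintro rfl
      exact Finset.ne_of_mem_erase h (Fin.ext (by simp))
    simp [h_ne]

theorem siteOp_comm (N : ℕ) {m n : ℕ} (h : m ≠ n) (A B : Matrix (Fin 2) (Fin 2) ℂ) :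
    Commute (siteOp N m A) (siteOp N n B) := by
  rw [Commute, SemiconjBy, siteOp, siteOp, tensor_mul, tensor_mul]
  ext f g
  simp only [Matrix.of_apply]
  refine Finset.prod_congr rfl fun p _ => ?_
  split_ifs <;> simp_all

theorem pauliAt_comm (N : ℕ) {m n : ℕ} (h : m ≠ n) (a b : Fin 3) :
    Commute (pauliAt N m a) (pauliAt N n b) := by
  simpa only [pauliAt_eq_siteOp] using siteOp_comm N h _ _

theorem pauliAt_sq (N n : ℕ) (a : Fin 3) : pauliAt N n a * pauliAt N n a = 1 := by
  rw [pauliAt_eq_siteOp, siteOp_mul, ← siteOp_one N n]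
  congr 1
  fin_cases a <;> ext i j <;> fin_cases i <;> fin_cases j <;>
    simp [pauli, Matrix.mul_apply]

/-- Distinct Pauli matrices on one qubit multiply to `± i` times the third one. -/
theorem pauliAt_mul (N n : ℕ) (hn : 1 ≤ n) (hnN : n ≤ N) {a b c : Fin 3} {z : ℂ}
    (h : pauli a * pauli b = z • pauli c) :
    pauliAt N n a * pauliAt N n b = z • pauliAt N n c := by
  rw [pauliAt_eq_siteOp, pauliAt_eq_siteOp, pauliAt_eq_siteOp, siteOp_mul, h,
    siteOp_smul N n hn hnN]

/-- The multiplication table of the Pauli matrices. -/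
def PauliRelations {R : Type*} [Ring R] [Algebra ℂ R] (s : Fin 3 → R) : Prop :=
  (∀ a, s a * s a = 1) ∧
    s 0 * s 1 = Complex.I • s 2 ∧ s 1 * s 0 = (-Complex.I) • s 2 ∧
    s 1 * s 2 = Complex.I • s 0 ∧ s 2 * s 1 = (-Complex.I) • s 0 ∧
    s 2 * s 0 = Complex.I • s 1 ∧ s 0 * s 2 = (-Complex.I) • s 1

theorem pauliRelations_pauliAt (N n : ℕ) (hn : 1 ≤ n) (hnN : n ≤ N) :
    PauliRelations (pauliAt N n) := by
  refine ⟨pauliAt_sq N n, ?_, ?_, ?_, ?_, ?_, ?_⟩ <;>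
    refine pauliAt_mul N n hn hnN ?_ <;>
    ext i j <;> fin_cases i <;> fin_cases j <;> simp [pauli, Matrix.mul_apply]

theorem PauliRelations.rotate {R : Type*} [Ring R] [Algebra ℂ R] {s : Fin 3 → R}
    (h : PauliRelations s) : PauliRelations fun a => s (a + 1) := by
  obtain ⟨h, h01, h10, h12, h21, h20, h02⟩ := h
  exact ⟨fun a => h (a + 1), h12, h21, h20, h02, h01, h10⟩

/-- `A · B` for two triples of operators. -/
def dot {R : Type*} [Ring R] (A B : Fin 3 → R) : R :=
  A 0 * B 0 + A 1 * B 1 + A 2 * B 2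

/-- The component of `A × B` along `a`. -/
def cross {R : Type*} [Ring R] (A B : Fin 3 → R) (a : Fin 3) : R :=
  A (a + 1) * B (a + 2) - A (a + 2) * B (a + 1)

theorem cross_zero_mul_dot {R : Type*} [Ring R] [Algebra ℂ R] {A B : Fin 3 → R}
    (hA : PauliRelations A) (hB : PauliRelations B) (h : ∀ a b, Commute (A a) (B b)) :
    cross A B 0 * dot A B = (2 * Complex.I) • (A 0 - B 0) - cross A B 0 ∧
      dot A B * cross A B 0 = -(2 * Complex.I) • (A 0 - B 0) - cross A B 0 := by
  obtain ⟨hA, a01, a10, a12, a21, a20, a02⟩ := hA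
  obtain ⟨hB, b01, b10, b12, b21, b20, b02⟩ := hB
  have key (a b c d) : A a * B b * (A c * B d) = (A a * A c) * (B b * B d) :=
    (h c b).symm.mul_mul_mul_comm _ _
  constructor <;>
  · simp only [cross, dot, zero_add, mul_add, add_mul, sub_mul, mul_sub, key, hA, hB, a01, a10,
      a12, a21, a20, a02, b01, b10, b12, b21, b20, b02, smul_mul_assoc, mul_smul_comm,
      smul_smul, mul_one, one_mul, neg_mul, mul_neg, neg_smul, smul_neg,
      Complex.I_mul_I, neg_neg, one_smul]
    module

/-- `(A × B)(A · B) = 2i(A - B) - A × B` and `(A · B)(A × B) = -2i(A - B) - A × B`. -/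
theorem cross_mul_dot {R : Type*} [Ring R] [Algebra ℂ R] {A B : Fin 3 → R}
    (hA : PauliRelations A) (hB : PauliRelations B) (h : ∀ a b, Commute (A a) (B b))
    (a : Fin 3) :
    cross A B a * dot A B = (2 * Complex.I) • (A a - B a) - cross A B a ∧
      dot A B * cross A B a = -(2 * Complex.I) • (A a - B a) - cross A B a := by
  have rotate (A B : Fin 3 → R) : dot (fun a => A (a + 1)) (fun a => B (a + 1)) = dot A B := by
    change A 1 * B 1 + A 2 * B 2 + A 0 * B 0 = A 0 * B 0 + A 1 * B 1 + A 2 * B 2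
    abel
  fin_cases a
  · exact cross_zero_mul_dot hA hB h
  · have h1 := cross_zero_mul_dot hA.rotate hB.rotate fun a b => h _ _
    rwa [rotate] at h1
  · have h2 := cross_zero_mul_dot hA.rotate.rotate hB.rotate.rotate fun a b => h _ _
    rwa [rotate (fun a => A (a + 1)) fun a => B (a + 1), rotate] at h2

/-- The commutator identity for four mutually commuting triples satisfying the Pauli
relations. -/
theorem comm_dot_cross {R : Type*} [Ring R] [Algebra ℂ R] {A B C D : Fin 3 → R}
    (hA : PauliRelations A) (hB : PauliRelations B) (hC : PauliRelations C)
    (hAB : ∀ a b, Commute (A a) (B b)) (hAC : ∀ a b, Commute (A a) (C b))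
    (hBC : ∀ a b, Commute (B a) (C b)) (hAD : ∀ a b, Commute (A a) (D b))
    (hBD : ∀ a b, Commute (B a) (D b)) (hCD : ∀ a b, Commute (C a) (D b)) :
    Complex.I • (dot (cross A B) C * (dot A B * dot C D)
        - (dot A B * dot C D) * dot (cross A B) C)
      = (4 : ℂ) • (dot B D - dot A D)
        + (2 : ℂ) • (dot A D * dot B C - dot A C * dot B D) := by
  have hHC (c) : Commute (dot A B) (C c) :=
    (((hAC _ _).mul_left (hBC _ _)).add_left ((hAC _ _).mul_left (hBC _ _))).add_left
      ((hAC _ _).mul_left (hBC _ _))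
  have hXC (a c) : Commute (cross A B a) (C c) :=
    ((hAC _ _).mul_left (hBC _ _)).sub_left ((hAC _ _).mul_left (hBC _ _))
  have hXD (a c) : Commute (cross A B a) (D c) :=
    ((hAD _ _).mul_left (hBD _ _)).sub_left ((hAD _ _).mul_left (hBD _ _))
  have hl (c d) : cross A B c * C c * (dot A B * (C d * D d)) =
      ((2 * Complex.I) • (A c - B c) - cross A B c) * (C c * C d * D d) := by
    rw [← (cross_mul_dot hA hB hAB c).1, (hHC c).symm.mul_mul_mul_comm, mul_assoc (C c)]
  have hr (c d) : dot A B * (C d * D d) * (cross A B c * C c) =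
      (-(2 * Complex.I) • (A c - B c) - cross A B c) * (C d * C c * D d) := by
    rw [← (cross_mul_dot hA hB hAB c).2,
      ((hXC c d).mul_right (hXD c d)).symm.mul_mul_mul_comm, mul_assoc (C d), mul_assoc (C d),
      (hCD c d).eq]
  have hADBC (a b) : A a * D a * (B b * C b) = A a * B b * (C b * D a) := by
    rw [(hBD b a).symm.mul_mul_mul_comm, (hCD b a).eq]
  have hACBD (a b) : A a * C a * (B b * D b) = A a * B b * (C a * D b) :=
    (hBC b a).symm.mul_mul_mul_comm _ _
  have hlhs : dot (cross A B) C * (dot A B * dot C D) =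
      ∑ c, ∑ d, cross A B c * C c * (dot A B * (C d * D d)) := by
    simp only [← Finset.mul_sum, ← Finset.sum_mul, Fin.sum_univ_three]
    rfl
  have hrhs : dot A B * dot C D * dot (cross A B) C =
      ∑ c, ∑ d, dot A B * (C d * D d) * (cross A B c * C c) := by
    simp only [← Finset.mul_sum, ← Finset.sum_mul, Fin.sum_univ_three]
    rfl
  obtain ⟨hC, c01, c10, c12, c21, c20, c02⟩ := hC
  have hI (x : R) : (Complex.I * Complex.I) • x = -x := by simp
  have hI2 (x : R) : (Complex.I * (2 * Complex.I)) • x = -((2 : ℂ) • x) := by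
    rw [mul_left_comm, Complex.I_mul_I]; module
  rw [hlhs, hrhs]
  simp only [hl, hr, Fin.sum_univ_three, hC, c01, c10, c12, c21, c20, c02]
  have e1 : (1 : Fin 3) + 1 = 2 := rfl
  have e2 : (1 : Fin 3) + 2 = 0 := rfl
  have e3 : (2 : Fin 3) + 1 = 0 := rfl
  have e4 : (2 : Fin 3) + 2 = 1 := rfl
  simp only [dot, cross, e1, e2, e3, e4, zero_add, mul_add, add_mul, sub_mul, hADBC,
    hACBD, smul_mul_assoc, mul_smul_comm, one_mul, neg_smul, smul_add, smul_sub, smul_neg,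
    mul_neg, neg_mul, smul_smul, hI, hI2]
  module

theorem twoBody_eq_dot (N m n : ℕ) : twoBody N m n = dot (pauliAt N m) (pauliAt N n) := by
  simp [twoBody, dot, Fin.sum_univ_three]

theorem threeBody_eq_dot (N i j k : ℕ) :
    threeBody N i j k = dot (cross (pauliAt N i) (pauliAt N j)) (pauliAt N k) := by
  have e1 : (1 : Fin 3) + 1 = 2 := rfl
  have e2 : (1 : Fin 3) + 2 = 0 := rfl
  have e3 : (2 : Fin 3) + 1 = 0 := rfl
  have e4 : (2 : Fin 3) + 2 = 1 := rfl
  simp [threeBody, dot, cross, eps, Fin.sum_univ_three, e1, e2, e3, e4, sub_mul]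
  abel

/-- For pairwise distinct sites `i, j, k, ℓ` of an `N`-qubit system,
`i[H_{ijk}, H_{ij}H_{kℓ}] = 4(H_{jℓ} − H_{iℓ}) + 2(H_{iℓ}H_{jk} − H_{ik}H_{jℓ})`. -/
theorem comm_threeBody_product (N i j k l : ℕ)
    (hi : 1 ≤ i) (hj : 1 ≤ j) (hk : 1 ≤ k) (hl : 1 ≤ l)
    (hiN : i ≤ N) (hjN : j ≤ N) (hkN : k ≤ N) (hlN : l ≤ N)
    (hij : i ≠ j) (hik : i ≠ k) (hil : i ≠ l)
    (hjk : j ≠ k) (hjl : j ≠ l) (hkl : k ≠ l) :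
    Complex.I • (threeBody N i j k * (twoBody N i j * twoBody N k l)
        - (twoBody N i j * twoBody N k l) * threeBody N i j k)
      = (4 : ℂ) • (twoBody N j l - twoBody N i l)
        + (2 : ℂ) • (twoBody N i l * twoBody N j k - twoBody N i k * twoBody N j l) := by
  simp only [twoBody_eq_dot, threeBody_eq_dot]
  exact comm_dot_cross (pauliRelations_pauliAt N i hi hiN) (pauliRelations_pauliAt N j hj hjN)
    (pauliRelations_pauliAt N k hk hkN) (pauliAt_comm N hij) (pauliAt_comm N hik)
    (pauliAt_comm N hjk) (pauliAt_comm N hil) (pauliAt_comm N hjl) (pauliAt_comm N hkl)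
end
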